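/- Let F be a free group of rank 2 with basis {x, y} and let φ be the quasi-conjugation φ(x) = x⁻¹, φ(y) = x y x⁻¹. Then the centralizer of φ in Aut(F) has exactly four elements, all of order dividing 2. -/

import Mathlib

namespace FreeGroup

variable {X : Type*}

/-- The endomorphism of a free group inverting exactly the generators `a` with `ε a = true`. -/
def signHom (ε : X → Bool) : FreeGroup X →* FreeGroup X :=
  lift fun a => mk [(a, !ε a)]

theorem mk_cons_eq_mul (p : X × Bool) (L : List (X × Bool)) : mk (p :: L) = mk [p] * mk L := by
  rw [mul_mk]; rfl

theorem signHom_of (ε : X → Bool) (a : X) : signHom ε (of a) = mk [(a, !ε a)] := lift_apply_of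

theorem signHom_mk (ε : X → Bool) (L : List (X × Bool)) :
    signHom ε (mk L) = mk (L.map fun p => (p.1, xor p.2 (ε p.1))) := by
  induction L with
  | nil => exact _root_.map_one _
  | cons p L ih =>
    rw [mk_cons_eq_mul, _root_.map_mul, ih, List.map_cons, mk_cons_eq_mul (_, _) (List.map _ L)]
    congr 1
    obtain ⟨a, b⟩ := p
    cases b
    · have : (mk [(a, false)] : FreeGroup X) = (of a)⁻¹ := rfl
      rw [this, _root_.map_inv, signHom_of, inv_mk]
      simp [invRev]
    · simpa using! signHom_of ε a

theorem signHom_signHom (ε : X → Bool) (g : FreeGroup X) : signHom ε (signHom ε g) = g := by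
  induction g using Quot.inductionOn with
  | _ L => simp [quot_mk_eq_mk, signHom_mk, Function.comp_def]

/-- `FreeGroup.signHom` as an automorphism. -/
def signAut (ε : X → Bool) : MulAut (FreeGroup X) :=
  { signHom ε with
    invFun := signHom ε
    left_inv := signHom_signHom ε
    right_inv := signHom_signHom ε }

theorem signAut_mk (ε : X → Bool) (L : List (X × Bool)) :
    signAut ε (mk L) = mk (L.map fun p => (p.1, xor p.2 (ε p.1))) := signHom_mk ε L

theorem signAut_of (ε : X → Bool) (a : X) : signAut ε (of a) = mk [(a, !ε a)] := signHom_of ε a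

theorem toWord_signAut [DecidableEq X] (ε : X → Bool) (g : FreeGroup X) :
    (signAut ε g).toWord = g.toWord.map fun p => (p.1, xor p.2 (ε p.1)) := by
  conv_lhs => rw [← mk_toWord (x := g), signAut_mk, toWord_mk]
  apply IsReduced.reduce_eq
  refine List.isChain_map_of_isChain _ ?_ (isReduced_toWord (x := g))
  rintro ⟨a, b⟩ ⟨c, d⟩ h (rfl : a = c)
  simpa using h rfl

theorem mulAut_ext {α β : MulAut (FreeGroup X)} (h : ∀ a, α (of a) = β (of a)) : α = β :=
  MulEquiv.toMonoidHom_injective (ext_hom _ _ h)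

/-- The reduced word of an element inverted by a sign change is a palindrome up to signs. -/
theorem map_eq_reverse_of_signAut_eq_inv [DecidableEq X] {ε : X → Bool} {t : FreeGroup X}
    (ht : signAut ε t = t⁻¹) :
    t.toWord.map (fun p => (p.1, xor p.2 (!ε p.1))) = t.toWord.reverse := by
  have h := congrArg toWord ht
  rw [toWord_signAut, toWord_inv, invRev] at h
  have h' := congrArg (List.map fun p : X × Bool => (p.1, !p.2)) h
  rw [← List.map_reverse] at h'
  simpa [Function.comp_def] using h'

/-- Elements inverted by a sign change are twisted conjugate to `1` or to a letter. -/
theorem exists_eq_twisted_conj {ε : X → Bool} {t : FreeGroup X} (ht : signAut ε t = t⁻¹) :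
    ∃ h m, t = (signAut ε h)⁻¹ * m * h ∧ (m = 1 ∨ ∃ a b, ε a = true ∧ m = mk [(a, b)]) := by
  classical
  suffices H : ∀ L : List (X × Bool), L.map (fun p => (p.1, xor p.2 (!ε p.1))) = L.reverse →
      ∃ h m, mk L = (signAut ε h)⁻¹ * m * h ∧ (m = 1 ∨ ∃ a b, ε a = true ∧ m = mk [(a, b)]) by
    simpa only [mk_toWord] using H _ (map_eq_reverse_of_signAut_eq_inv ht)
  intro L
  induction L using List.bidirectionalRec with
  | nil => exact fun _ => ⟨1, 1, by simp [← one_eq_mk], .inl rfl⟩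
  | singleton p =>
    intro h
    obtain ⟨a, b⟩ := p
    refine ⟨1, mk [(a, b)], by simp, .inr ⟨a, b, ?_, rfl⟩⟩
    cases b <;> simpa using h
  | cons_append p L q ih =>
    intro h
    simp only [List.map_cons, List.map_append, List.map_nil, List.reverse_cons, List.reverse_append,
      List.reverse_nil, List.nil_append, List.cons_append, List.cons.injEq] at h
    obtain ⟨hpq, h⟩ := h
    replace h := (List.append_inj' h rfl).1
    obtain ⟨g, m, hg, hm⟩ := ih h
    refine ⟨g * mk [q], m, ?_, hm⟩
    have hp : mk [p] = (signAut ε (mk [q]))⁻¹ := by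
      rw [signAut_mk, inv_mk, ← hpq]
      simp [invRev]
    rw [mk_cons_eq_mul, ← mul_mk, hg, hp, _root_.map_mul]
    group

/-- An element inverted by a sign change is conjugate, by a fixed element, to one whose word begins
and ends with the same inverted letter. -/
theorem exists_conj_head_eq_getLast [DecidableEq X] {ε : X → Bool} {t : FreeGroup X}
    (ht : signAut ε t = t⁻¹) (ht1 : t ≠ 1) :
    ∃ h w, signAut ε h = h ∧ t = h * w * h⁻¹ ∧ ∃ a b, ε a = true ∧
      w.toWord.head? = some (a, b) ∧ w.toWord.getLast? = some (a, b) := by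
  suffices H : ∀ L : List (X × Bool), IsReduced L →
      L.map (fun p => (p.1, xor p.2 (!ε p.1))) = L.reverse → mk L ≠ 1 →
      ∃ h w, signAut ε h = h ∧ mk L = h * w * h⁻¹ ∧ ∃ a b, ε a = true ∧
        w.toWord.head? = some (a, b) ∧ w.toWord.getLast? = some (a, b) by
    simpa only [mk_toWord] using
      H _ isReduced_toWord (map_eq_reverse_of_signAut_eq_inv ht) (by rwa [mk_toWord])
  intro L
  induction L using List.bidirectionalRec with
  | nil => exact fun _ _ h => absurd rfl h
  | singleton p =>
    intro _ h _
    obtain ⟨a, b⟩ := p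
    exact ⟨1, mk [(a, b)], by simp, by simp, a, b, by cases b <;> simpa using h,
      by simp, by simp⟩
  | cons_append p L q ih =>
    intro hred h hne
    simp only [List.map_cons, List.map_append, List.map_nil, List.reverse_cons, List.reverse_append,
      List.reverse_nil, List.nil_append, List.cons_append, List.cons.injEq] at h
    obtain ⟨hpq, h⟩ := h
    replace h := (List.append_inj' h rfl).1
    obtain ⟨a, b⟩ := p
    cases hε : ε a with
    | true =>
      refine ⟨1, mk ((a, b) :: (L ++ [q])), by simp, by simp, a, b, hε, ?_, ?_⟩
      · simp [hred.reduce_eq]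
      · rw [toWord_mk, hred.reduce_eq, ← hpq, hε]
        simp [List.getLast?_cons]
    | false =>
      have hq : mk [q] = (mk [(a, b)])⁻¹ := by
        rw [← hpq, inv_mk]; simp [invRev, hε]
      have hL : mk ((a, b) :: (L ++ [q])) = mk [(a, b)] * mk L * (mk [(a, b)])⁻¹ := by
        rw [mk_cons_eq_mul, ← mul_mk, hq, mul_assoc]
      have hL1 : mk L ≠ 1 := fun h1 => hne (by rw [hL, h1]; group)
      obtain ⟨g, w, hg, hw, hab⟩ := ih (hred.infix ⟨[(a, b)], [q], by simp⟩) h hL1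
      refine ⟨mk [(a, b)] * g, w, ?_, ?_, hab⟩
      · rw [_root_.map_mul, hg, signAut_mk]; simp [hε]
      · rw [hL, hw]; group

theorem forall_mem_toWord_of_signAut_eq [DecidableEq X] {ε : X → Bool} {g : FreeGroup X}
    (hg : signAut ε g = g) : ∀ p ∈ g.toWord, ε p.1 = false := by
  have h := congrArg toWord hg
  rw [toWord_signAut] at h
  intro p hp
  have := List.map_inj_left.1 (h.trans (List.map_id _).symm) p hp
  obtain ⟨a, b⟩ := p
  cases b <;> simpa using this

theorem IsReduced.eq_replicate {L : List (X × Bool)} (hL : IsReduced L) {y : X}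
    (h : ∀ p ∈ L, p.1 = y) : ∃ n b, L = List.replicate n (y, b) := by
  induction L with
  | nil => exact ⟨0, true, rfl⟩
  | cons p L ih =>
    obtain ⟨a, b⟩ := p
    obtain rfl : a = y := h _ List.mem_cons_self
    obtain ⟨n, c, rfl⟩ := ih (List.IsChain.tail hL) fun q hq => h q (List.mem_cons_of_mem _ hq)
    cases n with
    | zero => exact ⟨1, b, rfl⟩
    | succ n =>
      have : b = c := (List.isChain_cons_cons.1 hL).1 rfl
      exact ⟨n + 2, b, by rw [this]; rfl⟩

/-- If the image of each generator begins and ends with the same signed copy of that generator,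
then substitution into a reduced word involves no cancellation. -/
theorem toWord_map_eq_flatMap [DecidableEq X] {α : FreeGroup X →* FreeGroup X} {c : X → Bool}
    (h : ∀ p : X × Bool, (α (mk [p])).toWord.head? = some (p.1, xor p.2 (c p.1)) ∧
      (α (mk [p])).toWord.getLast? = some (p.1, xor p.2 (c p.1))) (g : FreeGroup X) :
    (α g).toWord = g.toWord.flatMap fun p => (α (mk [p])).toWord := by
  have hmk : ∀ L : List (X × Bool), α (mk L) = mk (L.flatMap fun p => (α (mk [p])).toWord) := by
    intro L
    induction L with
    | nil => exact _root_.map_one _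
    | cons p L ih =>
      rw [mk_cons_eq_mul, _root_.map_mul, ih, List.flatMap_cons, ← mul_mk, mk_toWord]
  conv_lhs => rw [← mk_toWord (x := g), hmk, toWord_mk]
  apply IsReduced.reduce_eq
  rw [List.flatMap, IsReduced, List.isChain_flatten]
  · constructor
    · intro l hl
      obtain ⟨p, -, rfl⟩ := List.mem_map.1 hl
      exact isReduced_toWord
    · refine List.isChain_map_of_isChain _ ?_ (isReduced_toWord (x := g))
      intro p q hpq a ha b hb
      rw [(h p).2] at ha
      rw [(h q).1] at hb
      simp only [Option.mem_def, Option.some.injEq] at ha hb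
      subst ha hb
      intro hpq'
      simp only at hpq'
      simp [hpq', hpq hpq']
  · intro hnil
    obtain ⟨p, -, hp⟩ := List.mem_map.1 hnil
    simpa [hp] using (h p).1

theorem eq_signAut_of_head_eq_getLast [DecidableEq X] {α : MulAut (FreeGroup X)}
    (h : ∀ a, ∃ b, (α (of a)).toWord.head? = some (a, b) ∧
      (α (of a)).toWord.getLast? = some (a, b)) : ∃ ε, α = signAut ε := by
  choose c hc using h
  have h : ∀ p : X × Bool,
      (α.toMonoidHom (mk [p])).toWord.head? = some (p.1, xor p.2 (!c p.1)) ∧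
        (α.toMonoidHom (mk [p])).toWord.getLast? = some (p.1, xor p.2 (!c p.1)) := by
    rintro ⟨a, b⟩
    cases b with
    | true => simpa using! hc a
    | false =>
      have : (mk [(a, false)] : FreeGroup X) = (of a)⁻¹ := rfl
      rw [this, _root_.map_inv, toWord_inv]
      have := hc a
      simp [invRev, this]
  have key : ∀ a, ∃ b, α (mk [(a, b)]) = of a := by
    intro a
    obtain ⟨g, hg⟩ := α.surjective (of a)
    have hw := toWord_map_eq_flatMap (α := α.toMonoidHom) (c := fun a => !c a) h g
    have hg' : α.toMonoidHom g = of a := hg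
    rw [hg', toWord_of] at hw
    have hne : ∀ p, (α.toMonoidHom (mk [p])).toWord ≠ [] := by
      intro p hp
      exact absurd (h p).1 (by rw [hp]; simp)
    rcases hL : g.toWord with _ | ⟨p, _ | ⟨q, L⟩⟩
    · simp [hL] at hw
    · rw [hL, List.flatMap_singleton] at hw
      have hp := (h p).1
      rw [← hw] at hp
      simp only [List.head?_cons, Option.some.injEq, Prod.mk.injEq] at hp
      refine ⟨p.2, toWord_injective ?_⟩
      rw [toWord_of, hw, hp.1]
      rfl
    · have hp := List.length_pos_iff.2 (hne p)
      have hq := List.length_pos_iff.2 (hne q)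
      have := congrArg List.length hw
      simp only [hL, List.flatMap_cons, List.length_append, List.length_singleton] at this
      omega
  choose ε hε using key
  refine ⟨fun a => !ε a, mulAut_ext fun a => ?_⟩
  rw [signAut_of, Bool.not_not]
  have := hε a
  cases h : ε a with
  | true => rw [h] at this; exact this
  | false =>
    have h' : (mk [(a, false)] : FreeGroup X) = (of a)⁻¹ := rfl
    rw [h, h', _root_.map_inv, inv_eq_iff_eq_inv] at this
    rw [this, h']

theorem IsReduced.cons_or {L : List (X × Bool)} (hL : IsReduced L) (p : X × Bool) :
    IsReduced (p :: L) ∨ ∃ R, L = (p.1, !p.2) :: R := by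
  rcases L with _ | ⟨⟨a, b⟩, R⟩
  · exact .inl .singleton
  · obtain ⟨a', b'⟩ := p
    by_cases h : a' = a ∧ b' ≠ b
    · exact .inr ⟨R, by simp [h.1, Bool.eq_not.2 h.2.symm]⟩
    · refine .inl (List.isChain_cons_cons.2 ⟨fun h' => ?_, hL⟩)
      by_contra h''
      exact h ⟨h', h''⟩

theorem IsReduced.append_singleton_or {L : List (X × Bool)} (hL : IsReduced L) (p : X × Bool) :
    IsReduced (L ++ [p]) ∨ ∃ R, L = R ++ [(p.1, !p.2)] := by
  rcases L.eq_nil_or_concat' with rfl | ⟨R, ⟨a, b⟩, rfl⟩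
  · exact .inl .singleton
  · obtain ⟨a', b'⟩ := p
    by_cases h : a = a' ∧ b ≠ b'
    · exact .inr ⟨R, by simp [h.1, Bool.eq_not.2 h.2]⟩
    · refine .inl (List.isChain_append.2 ⟨hL, .singleton _, ?_⟩)
      intro r hr s hs h'
      simp at hr hs
      subst hr hs
      by_contra h''
      exact h ⟨h', h''⟩

/-- Two reduced words of the same length related by moving a letter across. -/
theorem append_eq_cons_or [DecidableEq X] {P Q : List (X × Bool)} (hP : IsReduced P)
    (hQ : IsReduced Q) (hPQ : P.length = Q.length) {p q : X × Bool}
    (h : mk (P ++ [q]) = mk (p :: Q)) :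
    (IsReduced (p :: Q) ∧ P ++ [q] = p :: Q) ∨
      ∃ R, Q = (p.1, !p.2) :: R ∧ P = R ++ [(q.1, !q.2)] := by
  have eq_of_mk {L M : List (X × Bool)} (hL : IsReduced L) (hM : IsReduced M)
      (h : mk L = mk M) : L = M := by
    rw [← hL.reduce_eq, ← hM.reduce_eq, ← toWord_mk, h, toWord_mk]
  have hcons (R : List (X × Bool)) : mk (p :: (p.1, !p.2) :: R) = mk R := by
    exact Quot.sound (Red.Step.not (L₁ := []) (L₂ := R) (x := p.1) (b := p.2))
  have happ (R : List (X × Bool)) : mk (R ++ [(q.1, !q.2)] ++ [q]) = mk R := by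
    rw [List.append_assoc]
    exact (Quot.sound (Red.Step.not_rev (L₁ := R) (L₂ := []) (x := q.1) (b := q.2))).trans
      (by simp; rfl)
  rcases hP.append_singleton_or q with h1 | ⟨R, rfl⟩ <;> rcases hQ.cons_or p with h2 | ⟨S, rfl⟩
  · exact .inl ⟨h2, eq_of_mk h1 h2 h⟩
  · have := congrArg List.length
      (eq_of_mk h1 (hQ.infix ⟨[_], [], by simp; rfl⟩) (h.trans (hcons S)))
    simp at this hPQ
    omega
  · have := congrArg List.length (eq_of_mk (hP.infix ⟨[], [_], rfl⟩) h2 ((happ R).symm.trans h))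
    simp at this hPQ
    omega
  · obtain rfl := eq_of_mk (hP.infix ⟨[], [_], rfl⟩) (hQ.infix ⟨[_], [], by simp; rfl⟩)
      ((happ R).symm.trans (h.trans (hcons S)))
    exact .inr ⟨R, rfl, rfl⟩

/-- An element of a free group commuting with two distinct generators is trivial. -/
theorem eq_one_of_commute_of [DecidableEq X] {x y : X} (hxy : x ≠ y) {z : FreeGroup X}
    (hx : z * of x = of x * z) (hy : z * of y = of y * z) : z = 1 := by
  have key : ∀ a, z * of a = of a * z → ∀ p ∈ z.toWord.head?, p.1 = a := by
    intro a ha p hp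
    have : mk (z.toWord ++ [(a, true)]) = mk ((a, true) :: z.toWord) := by
      rw [mk_cons_eq_mul, ← mul_mk, mk_toWord]; exact ha
    rcases append_eq_cons_or isReduced_toWord isReduced_toWord rfl this with ⟨-, h⟩ | ⟨R, h, -⟩
    · cases hz : z.toWord with
      | nil => simp [hz] at hp
      | cons q L =>
        rw [hz] at h hp
        simp at h hp
        rw [← hp, h.1]
    · rw [h] at hp
      simp at hp
      simp [← hp]
  rw [← toWord_eq_nil_iff]
  cases hz : z.toWord with
  | nil => rfl
  | cons q L =>
    exact absurd ((key x hx q (by simp [hz])).symm.trans (key y hy q (by simp [hz]))) hxy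

/-- The automorphism `g ↦ x * signAut ε g * x⁻¹` has no nontrivial fixed point if `ε x`. -/
theorem eq_one_of_of_mul_signAut_eq [DecidableEq X] {ε : X → Bool} {x : X} (hx : ε x = true)
    {c : FreeGroup X} (h : of x * signAut ε c = c * of x) : c = 1 := by
  have h' : mk (c.toWord ++ [(x, true)]) = mk ((x, true) :: (signAut ε c).toWord) := by
    rw [mk_cons_eq_mul, ← mul_mk, mk_toWord, mk_toWord]; exact h.symm
  rw [← toWord_eq_nil_iff]
  rcases append_eq_cons_or isReduced_toWord isReduced_toWord (by simp [toWord_signAut]) h' with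
    ⟨hr, h⟩ | ⟨R, h1, h2⟩
  · cases hc : c.toWord with
    | nil => rfl
    | cons q L =>
      rw [hc] at h
      simp only [List.cons_append, List.cons.injEq] at h
      rw [toWord_signAut, hc, h.1] at hr
      simpa [hx] using (List.isChain_cons_cons.1 hr).1 rfl
  · exfalso
    rw [toWord_signAut, h2] at h1
    cases R with
    | nil => simp [hx] at h1
    | cons r R =>
      simp only [List.cons_append, List.map_cons, List.cons.injEq] at h1
      have hr := isReduced_toWord (x := c)
      have hr := isReduced_toWord (x := signAut ε c)
      rw [toWord_signAut, h2, List.cons_append, List.map_cons, h1.1, h1.2] at hr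
      obtain ⟨a, b⟩ := r
      obtain ⟨⟨rfl, hb⟩, -⟩ := And.intro (Prod.mk.inj h1.1) h1.2
      have := (List.isChain_cons_cons.1 hr).1 rfl
      simp_all

/-- An automorphism commuting with inversion of one of the two generators is, up to an inner
automorphism, a sign change. -/
theorem exists_eq_conj_mul_signAut [DecidableEq X] {x y : X} (hxy : x ≠ y)
    (hcover : ∀ a : X, a = x ∨ a = y) {β : MulAut (FreeGroup X)}
    (hβ : ∀ g, signAut (fun a => decide (a = x)) (β g) =
      β (signAut (fun a => decide (a = x)) g)) :
    ∃ h ε, β = MulAut.conj h * signAut ε := by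
  have hSx : signAut (fun a => decide (a = x)) (of x) = (of x)⁻¹ := by
    rw [signAut_of]; simp; rfl
  have hSy : signAut (fun a => decide (a = x)) (of y) = of y := by
    rw [signAut_of]; simp [hxy.symm]; rfl
  obtain ⟨h, w, hh, hw, a, b, ha, hhead, hlast⟩ := exists_conj_head_eq_getLast
    (t := β (of x)) (by rw [hβ, hSx, _root_.map_inv])
    (fun h => of_ne_one x (β.injective (h.trans (_root_.map_one β).symm)))
  obtain rfl : a = x := by simpa using ha
  have hαy : signAut (fun b => decide (b = a)) (h⁻¹ * β (of y) * h) = h⁻¹ * β (of y) * h := by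
    rw [_root_.map_mul, _root_.map_mul, _root_.map_inv, hh, hβ, hSy]
  have hαy1 : h⁻¹ * β (of y) * h ≠ 1 := by
    intro h1
    have : β (of y) = 1 := by
      rw [← mul_left_inj h, ← mul_right_inj h⁻¹, ← mul_assoc, h1]; group
    exact of_ne_one y (β.injective (this.trans (_root_.map_one β).symm))
  obtain ⟨n, s, hn⟩ := IsReduced.eq_replicate (isReduced_toWord (x := h⁻¹ * β (of y) * h)) (y := y)
    fun p hp => (hcover p.1).resolve_left
      (by simpa using forall_mem_toWord_of_signAut_eq hαy p hp)
  have hn0 : n ≠ 0 := by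
    rintro rfl
    exact hαy1 (toWord_eq_nil_iff.1 hn)
  obtain ⟨ε, hε⟩ := eq_signAut_of_head_eq_getLast (α := MulAut.conj h⁻¹ * β) fun c => by
    have hc : (MulAut.conj h⁻¹ * β) (of c) = h⁻¹ * β (of c) * h := by simp
    rw [hc]
    rcases hcover c with rfl | rfl
    · refine ⟨b, ?_⟩
      rw [hw, show h⁻¹ * (h * w * h⁻¹) * h = w by group]
      exact ⟨hhead, hlast⟩
    · refine ⟨s, ?_⟩
      rw [hn]
      simp [List.head?_replicate, List.getLast?_replicate, hn0]
  exact ⟨h, ε, by rw [← hε, ← mul_assoc, ← _root_.map_mul]; simp⟩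

theorem signAut_mul_signAut (ε ε' : X → Bool) :
    signAut ε * signAut ε' = signAut fun a => xor (ε a) (ε' a) := by
  refine mulAut_ext fun a => ?_
  rw [MulAut.mul_apply, signAut_of, signAut_of, signAut_mk]
  cases h : ε a <;> cases h' : ε' a <;> simp [h]

/-- The value on `σ x` of a character to an elementary abelian 2-group rules out odd twisted
conjugates. -/
theorem apply_ne_twisted_conj [DecidableEq X] (σ : MulAut (FreeGroup X)) (ε : X → Bool) (x : X)
    (h : FreeGroup X) (b : Bool) :
    σ (of x) * of x ≠ (signAut ε h)⁻¹ * mk [(x, b)] * h := by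
  intro heq
  let χ : FreeGroup X →* Multiplicative (ZMod 2) :=
    (lift fun a => if a = x then Multiplicative.ofAdd 1 else 1).comp σ⁻¹.toMonoidHom
  have hinv : ∀ z : Multiplicative (ZMod 2), z⁻¹ = z := by decide
  have hmk : ∀ a b, χ (mk [(a, b)]) = χ (of a) := by
    intro a b
    cases b
    · have : (mk [(a, false)] : FreeGroup X) = (of a)⁻¹ := rfl
      rw [this, _root_.map_inv, hinv]
    · rfl
  have hS : χ.comp (signAut ε).toMonoidHom = χ := by
    refine ext_hom _ _ fun a => ?_
    change χ (signAut ε (of a)) = _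
    rw [signAut_of, hmk]
  have hSh : χ (signAut ε h) = χ h := DFunLike.congr_fun hS h
  have h1 : χ (σ (of x)) = Multiplicative.ofAdd 1 := by
    simp [χ]
  have := congrArg χ heq
  simp only [_root_.map_mul, _root_.map_inv, hSh, hmk, h1] at this
  rw [mul_assoc, mul_comm (χ (of x)), inv_mul_cancel_left, mul_eq_right] at this
  exact absurd this (by decide)

/-- An inner automorphism commuting with `φ` is trivial if `φ` fixes only `1`. -/
theorem conj_eq_one_of_commute {x y : X} (hxy : x ≠ y)
    {φ : MulAut (FreeGroup X)} (hφ : ∀ c, φ c = c → c = 1) {c : FreeGroup X}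
    (hc : φ * MulAut.conj c = MulAut.conj c * φ) : c = 1 := by
  classical
  have hcomm : ∀ g, c⁻¹ * φ c * g = g * (c⁻¹ * φ c) := by
    intro g
    have := DFunLike.congr_fun hc (φ⁻¹ g)
    simp only [MulAut.mul_apply, MulAut.conj_apply, _root_.map_mul, _root_.map_inv,
      MulAut.apply_inv_self] at this
    rw [mul_inv_eq_iff_eq_mul] at this
    rw [mul_assoc, this]
    group
  exact hφ c (inv_mul_eq_one.1 (eq_one_of_commute_of hxy (hcomm _) (hcomm _))).symm

theorem mul_signAut_comm {x : X} {φ : MulAut (FreeGroup X)} {ε₀ ε : X → Bool}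
    (hφ : φ = MulAut.conj (of x) * signAut ε₀) (hε : ε x = false) :
    φ * signAut ε = signAut ε * φ := by
  have hx : signAut ε (of x) = of x := by rw [signAut_of, hε]; rfl
  have hconj : signAut ε * MulAut.conj (of x) = MulAut.conj (of x) * signAut ε := by
    ext g
    simp [hx]
  rw [hφ, ← mul_assoc, hconj, mul_assoc, mul_assoc, signAut_mul_signAut, signAut_mul_signAut]
  simp only [Bool.xor_comm]

/-- The centralizer of `conj x * signAut ε`, where `ε` singles out `x`, consists of products of
that automorphism with sign changes. -/
theorem exists_signAut_of_commute [DecidableEq X] {x y : X} (hxy : x ≠ y)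
    (hcover : ∀ a : X, a = x ∨ a = y) {φ σ : MulAut (FreeGroup X)}
    (hφ : φ = MulAut.conj (of x) * signAut fun a => decide (a = x)) (hσ : φ * σ = σ * φ) :
    ∃ ε : X → Bool, ε x = false ∧ (σ = signAut ε ∨ σ = φ * signAut ε) := by
  have hφS : ∀ g, signAut (fun a => decide (a = x)) g = (of x)⁻¹ * φ g * of x := by
    intro g
    rw [hφ, MulAut.mul_apply, MulAut.conj_apply]
    group
  have hσ' : ∀ g, φ (σ g) = σ (φ g) := DFunLike.congr_fun hσ
  have hφx : φ (of x) = (of x)⁻¹ := by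
    have : signAut (fun a => decide (a = x)) (of x) = (of x)⁻¹ := by
      rw [signAut_of]; simp; rfl
    rw [hφ, MulAut.mul_apply, MulAut.conj_apply, this]
    group
  have hfix : ∀ c, φ c = c → c = 1 := fun c hc =>
    eq_one_of_of_mul_signAut_eq (ε := fun a => decide (a = x)) (x := x) (by simp)
      (by rw [hφS, hc]; group)
  have hcancel : ∀ c τ, φ * τ = τ * φ → σ = MulAut.conj c * τ → σ = τ := by
    intro c τ hτ hστ
    have : c = 1 := by
      refine conj_eq_one_of_commute hxy hfix (mul_right_cancel (b := τ) ?_)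
      rw [mul_assoc, ← hστ, hσ, hστ, mul_assoc, mul_assoc, hτ]
    rw [hστ, this, _root_.map_one, one_mul]
  obtain ⟨h, m, ht, hm⟩ := exists_eq_twisted_conj (ε := fun a => decide (a = x))
    (t := σ (of x) * of x) (by
      rw [hφS, _root_.map_mul, hσ', hφx, _root_.map_inv]
      group)
  have hm1 : m = 1 := by
    refine hm.resolve_right ?_
    rintro ⟨a, b, ha, rfl⟩
    obtain rfl : a = x := by simpa using ha
    exact apply_ne_twisted_conj _ _ _ _ _ ht
  have hu : σ (of x) = (of x)⁻¹ * (φ h)⁻¹ * of x * h * (of x)⁻¹ := by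
    rw [hm1, hφS] at ht
    rw [← mul_left_inj (of x), ht]
    group
  obtain ⟨k, ε, hk⟩ := exists_eq_conj_mul_signAut hxy hcover
    (β := MulAut.conj (h * (of x)⁻¹) * σ) (by
      intro g
      have hconj : ∀ g, (MulAut.conj (h * (of x)⁻¹) * σ) g =
          h * (of x)⁻¹ * σ g * (h * (of x)⁻¹)⁻¹ := fun g => rfl
      rw [hφS, hφS, hconj, hconj]
      simp only [_root_.map_mul, _root_.map_inv, hσ', hφx, hu]
      group)
  have hσε : σ = MulAut.conj ((h * (of x)⁻¹)⁻¹ * k) * signAut ε := by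
    rw [_root_.map_mul, mul_assoc, ← hk, ← mul_assoc, ← _root_.map_mul]
    simp
  cases hε : ε x with
  | false => exact ⟨ε, hε, .inl (hcancel _ _ (mul_signAut_comm hφ hε) hσε)⟩
  | true =>
    let ε' : X → Bool := fun a => xor (decide (a = x)) (ε a)
    have hε' : ε' x = false := by simp [ε', hε]
    have hεε' : signAut ε = MulAut.conj (of x)⁻¹ * (φ * signAut ε') := by
      rw [hφ, mul_assoc, signAut_mul_signAut, ← mul_assoc, ← _root_.map_mul]
      simp [ε']
    refine ⟨ε', hε', .inr (hcancel ((h * (of x)⁻¹)⁻¹ * k * (of x)⁻¹) _ ?_ ?_)⟩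
    · rw [mul_assoc, mul_signAut_comm hφ hε']
    · rw [hσε, hεε', ← mul_assoc, ← _root_.map_mul]

end FreeGroup

/-- For a quasi-conjugation `φ` of a free group of rank 2, the centralizer of
`φ` in `Aut F` has exactly four elements, all of order dividing 2. -/
theorem centralizer_rank_two (X : Type*) (x y : X) (hxy : x ≠ y)
    (hcover : ∀ a : X, a = x ∨ a = y)
    (φ : MulAut (FreeGroup X))
    (hφx : φ (FreeGroup.of x) = (FreeGroup.of x)⁻¹)
    (hφy : φ (FreeGroup.of y)
      = FreeGroup.of x * FreeGroup.of y * (FreeGroup.of x)⁻¹) :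
    Nat.card (Subgroup.centralizer ({φ} : Set (MulAut (FreeGroup X)))) = 4 ∧
      ∀ σ ∈ Subgroup.centralizer ({φ} : Set (MulAut (FreeGroup X))),
        σ ^ 2 = 1 := by
  classical
  have hφ : φ = MulAut.conj (FreeGroup.of x) * FreeGroup.signAut fun a => decide (a = x) := by
    refine FreeGroup.mulAut_ext fun a => ?_
    rw [MulAut.mul_apply, FreeGroup.signAut_of, MulAut.conj_apply]
    rcases hcover a with rfl | rfl
    · have : (FreeGroup.mk [(a, false)] : FreeGroup X) = (FreeGroup.of a)⁻¹ := rfl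
      simp [hφx, this]
    · rw [hφy]
      simp [hxy.symm, FreeGroup.of]
  have hφ2 : φ * φ = 1 := by
    refine FreeGroup.mulAut_ext fun a => ?_
    rcases hcover a with rfl | rfl
    · simp [hφx]
    · simp only [MulAut.mul_apply, hφy, map_mul, map_inv, hφx, MulAut.one_apply]
      group
  have hmem : ∀ σ, σ ∈ Subgroup.centralizer ({φ} : Set (MulAut (FreeGroup X))) ↔
      ∃ ε : X → Bool, ε x = false ∧ (σ = FreeGroup.signAut ε ∨ σ = φ * FreeGroup.signAut ε) := by
    intro σ
    rw [Subgroup.mem_centralizer_singleton_iff]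
    constructor
    · exact fun h => FreeGroup.exists_signAut_of_commute hxy hcover hφ h.symm
    · rintro ⟨ε, hε, rfl | rfl⟩
      · exact (FreeGroup.mul_signAut_comm hφ hε).symm
      · rw [mul_assoc, ← FreeGroup.mul_signAut_comm hφ hε]
  have hS2 (ε : X → Bool) : FreeGroup.signAut ε * FreeGroup.signAut ε = 1 :=
    MulEquiv.ext (FreeGroup.signHom_signHom ε)
  constructor
  · let f : Bool × Bool → MulAut (FreeGroup X) := fun p =>
      (if p.1 then φ else 1) * FreeGroup.signAut fun a => if a = x then false else p.2
    have hfx (p) : f p (FreeGroup.of x) = FreeGroup.mk [(x, !p.1)] := by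
      cases h : p.1 <;> simp [f, h, FreeGroup.signAut_of]; exact hφx
    have hf : Function.Injective f := by
      intro p q hpq
      have h1 : p.1 = q.1 := by
        have := congrArg FreeGroup.toWord (DFunLike.congr_fun hpq (FreeGroup.of x))
        simpa [hfx] using this
      refine Prod.ext h1 ?_
      simp only [f, h1, mul_right_inj] at hpq
      have := congrArg FreeGroup.toWord (DFunLike.congr_fun hpq (FreeGroup.of y))
      simpa [FreeGroup.signAut_of, hxy.symm] using this
    have hrange : (Subgroup.centralizer ({φ} : Set (MulAut (FreeGroup X))) : Set _) =
        Set.range f := by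
      ext σ
      rw [SetLike.mem_coe, hmem]
      constructor
      · rintro ⟨ε, hε, h⟩
        have : ε = fun a => if a = x then false else ε y := by
          funext a
          rcases hcover a with rfl | rfl
          · simp [hε]
          · simp [hxy.symm]
        rcases h with rfl | rfl
        · exact ⟨(false, ε y), by simp only [f, ← this]; simp⟩
        · exact ⟨(true, ε y), by simp only [f, ← this]; simp⟩
      · rintro ⟨⟨b, c⟩, rfl⟩
        refine ⟨fun a => if a = x then false else c, by simp, ?_⟩
        cases b <;> simp [f]
    rw [← SetLike.coe_sort_coe, hrange, Nat.card_range_of_injective hf]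
    simp
  · intro σ hσ
    obtain ⟨ε, hε, rfl | rfl⟩ := (hmem σ).1 hσ
    · rw [pow_two, hS2]
    · rw [pow_two, mul_assoc, ← mul_assoc (FreeGroup.signAut ε), ← FreeGroup.mul_signAut_comm hφ hε,
        mul_assoc φ, hS2, mul_one, hφ2]
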